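/- Let α > 0, I = [a,T], fix points a = t_0 < t_1 < ⋯ < t_m < t_{m+1} = T, and let λ ≥ 0 and β_1, …, β_m > 0 be constants. Let u, v : I → ℝ be integrable and nonnegative with v nondecreasing. If u(t) ≤ v(t) + λ ∫_a^t (t − s)^{α−1} u(s) ds + ∑_{a < t_i < t} β_i u(t_i) for all t ∈ I, then for every k ∈ {0,1,…,m} and every t ∈ (t_k, t_{k+1}], u(t) ≤ v(t) · [ ∏_{i=1}^{k} (1 + β_i E_α(λ Γ(α)(t_i − a)^α)) ] · E_α(λ Γ(α)(t − a)^α). -/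

import Mathlib

open MeasureTheory Finset

/-- The Mittag-Leffler function `E_α(z) = ∑_{k=0}^∞ z^k / Γ(αk + 1)`. -/
noncomputable def mittagLeffler (α z : ℝ) : ℝ :=
  ∑' k : ℕ, z ^ k / Real.Gamma (α * k + 1)

/-- The Riemann–Liouville convolution kernel `x ↦ x ^ (α - 1)`, extended by zero to `x < 0`. -/
noncomputable def rlKernel (α x : ℝ) : ENNReal :=
  ENNReal.ofReal (if 0 ≤ x then x ^ (α - 1) else 0)

lemma measurable_rlKernel (α : ℝ) : Measurable (rlKernel α) :=
  (Measurable.ite measurableSet_Ici (by fun_prop) (by fun_prop)).ennreal_ofReal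

lemma pow_le_exp_mul_Gamma {α x : ℝ} (hα : 0 < α) (hx : 0 ≤ x) (n : ℕ) :
    x ^ n ≤ Real.exp (x ^ α⁻¹) * Real.Gamma (α * n + 1) := by
  set M := x ^ α⁻¹ with hM
  have hM0 : 0 ≤ M := by positivity
  have hpow : M ^ (α * n) = x ^ n := by
    rw [hM, ← Real.rpow_mul hx, ← mul_assoc, inv_mul_cancel₀ hα.ne', one_mul, Real.rpow_natCast]
  have hpos : (0 : ℝ) < α * n + 1 := by positivity
  have hint := Real.GammaIntegral_convergent hpos
  have hsub : Set.Ioi M ⊆ Set.Ioi 0 := Set.Ioi_subset_Ioi hM0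
  have key : Real.exp (-M) * x ^ n ≤ Real.Gamma (α * n + 1) := by
    rw [Real.Gamma_eq_integral hpos, ← integral_exp_neg_Ioi, ← integral_mul_const]
    calc ∫ y in Set.Ioi M, Real.exp (-y) * x ^ n
        ≤ ∫ y in Set.Ioi M, Real.exp (-y) * y ^ (α * n + 1 - 1) := by
          refine setIntegral_mono_on ((integrableOn_exp_neg_Ioi M).mul_const _)
            (hint.mono_set hsub) measurableSet_Ioi fun y hy => ?_
          rw [← hpow, add_sub_cancel_right]
          have : M ≤ y := le_of_lt hy
          gcongr
      _ ≤ _ := by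
          refine setIntegral_mono_set hint ?_ hsub.eventuallyLE
          filter_upwards [ae_restrict_mem measurableSet_Ioi] with y hy
          have : (0 : ℝ) < y := hy
          simp only [Pi.zero_apply]
          positivity
  calc x ^ n = Real.exp M * (Real.exp (-M) * x ^ n) := by
        rw [← mul_assoc, ← Real.exp_add]; simp
    _ ≤ _ := by gcongr

lemma summable_mittagLeffler {α z : ℝ} (hα : 0 < α) (hz : 0 ≤ z) :
    Summable fun n : ℕ => z ^ n / Real.Gamma (α * n + 1) := by
  set C := Real.exp ((2 * (z + 1)) ^ α⁻¹)
  refine Summable.of_nonneg_of_le (f := fun n : ℕ => C * (1 / 2) ^ n) (fun n => ?_) (fun n => ?_)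
    (summable_geometric_two.mul_left C)
  · have := Real.Gamma_pos_of_pos (show (0 : ℝ) < α * n + 1 by positivity)
    positivity
  · have hG := Real.Gamma_pos_of_pos (show (0 : ℝ) < α * n + 1 by positivity)
    have h := pow_le_exp_mul_Gamma hα (show 0 ≤ 2 * (z + 1) by positivity) n
    rw [div_le_iff₀ hG]
    calc z ^ n ≤ (z + 1) ^ n := by gcongr; linarith
      _ = (1 / 2) ^ n * (2 * (z + 1)) ^ n := by rw [← mul_pow]; congr 1; ring
      _ ≤ (1 / 2) ^ n * (C * Real.Gamma (α * n + 1)) := by gcongr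
      _ = _ := by ring

lemma mittagLeffler_nonneg {α z : ℝ} (hα : 0 < α) (hz : 0 ≤ z) : 0 ≤ mittagLeffler α z :=
  tsum_nonneg fun n => div_nonneg (by positivity)
    (Real.Gamma_pos_of_pos (show (0 : ℝ) < α * n + 1 by positivity)).le

lemma ofReal_mittagLeffler {α z : ℝ} (hα : 0 < α) (hz : 0 ≤ z) :
    ENNReal.ofReal (mittagLeffler α z) =
      ∑' n : ℕ, ENNReal.ofReal (z ^ n / Real.Gamma (α * n + 1)) :=
  ENNReal.ofReal_tsum_of_nonneg (fun n => div_nonneg (by positivity)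
    (Real.Gamma_pos_of_pos (show (0 : ℝ) < α * n + 1 by positivity)).le)
    (summable_mittagLeffler hα hz)

lemma lintegral_exp_mul_rlKernel {α μ : ℝ} (hα : 0 < α) (hμ : 0 < μ) (r : ℝ) :
    ∫⁻ s, ENNReal.ofReal (Real.exp (-(μ * (s - r)))) * rlKernel α (s - r) =
      ENNReal.ofReal (Real.Gamma α / μ ^ α) := by
  rw [lintegral_sub_right_eq_self
    (fun x => ENNReal.ofReal (Real.exp (-(μ * x))) * rlKernel α x) r]
  have hG := Real.Gamma_pos_of_pos hα
  have hp := Real.rpow_pos_of_pos hμ α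
  have : ∀ x, ENNReal.ofReal (Real.exp (-(μ * x))) * rlKernel α x =
      ENNReal.ofReal (Real.Gamma α / μ ^ α) * ProbabilityTheory.gammaPDF α μ x := by
    intro x
    rw [rlKernel, ProbabilityTheory.gammaPDF_eq, ← ENNReal.ofReal_mul (by positivity),
      ← ENNReal.ofReal_mul (by positivity)]
    congr 1
    split_ifs
    · field_simp
    · simp
  simp_rw [this]
  rw [lintegral_const_mul' _ _ ENNReal.ofReal_ne_top,
    ProbabilityTheory.lintegral_gammaPDF_eq_one hα hμ, mul_one]

lemma lintegral_rlKernel_mul_rpow {α p a b t : ℝ} (hα : 0 < α) (hp : 0 ≤ p)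
    (ht : t ∈ Set.Ioc a b) :
    ∫⁻ r in Set.Ioc a b, rlKernel α (t - r) * ENNReal.ofReal ((r - a) ^ p) =
      ENNReal.ofReal (Real.Gamma α * Real.Gamma (p + 1) / Real.Gamma (p + 1 + α) *
        (t - a) ^ (p + α)) := by
  have hta : 0 < t - a := sub_pos.2 ht.1
  have h1 : ∫⁻ r in Set.Ioc a b, rlKernel α (t - r) * ENNReal.ofReal ((r - a) ^ p) =
      ∫⁻ r in Set.Ioo a t, rlKernel α (t - r) * ENNReal.ofReal ((r - a) ^ p) := by
    rw [← lintegral_indicator measurableSet_Ioc, ← lintegral_indicator measurableSet_Ioo]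
    refine lintegral_congr_ae ?_
    filter_upwards [Measure.ae_ne volume t] with r hr
    rcases lt_or_gt_of_ne hr with h | h
    · by_cases ha : a < r
      · rw [Set.indicator_of_mem (show r ∈ Set.Ioc a b from ⟨ha, h.le.trans ht.2⟩),
          Set.indicator_of_mem (show r ∈ Set.Ioo a t from ⟨ha, h⟩)]
      · rw [Set.indicator_of_notMem (fun h' => ha h'.1), Set.indicator_of_notMem (fun h' => ha h'.1)]
    · rw [Set.indicator_of_notMem (s := Set.Ioo a t) (fun h' => absurd h'.2 h.le.not_gt)]
      refine Set.indicator_apply_eq_zero.2 fun _ => ?_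
      simp [rlKernel, h.not_ge]
  have himg : (fun x : ℝ => (t - a) * x + a) '' Set.Ioo 0 1 = Set.Ioo a t := by
    rw [Set.image_affine_Ioo hta]
    simp
  rw [h1, ← himg, lintegral_image_eq_lintegral_abs_deriv_mul (f' := fun _ => t - a)
    measurableSet_Ioo (fun x _ => by
      simpa using (((hasDerivAt_id x).const_mul (t - a)).add_const a).hasDerivWithinAt)
    (fun x _ y _ h => by simpa [hta.ne'] using h)]
  have hB := ProbabilityTheory.beta_pos (show 0 < p + 1 by positivity) hα
  have h2 : ∀ x ∈ Set.Ioo (0 : ℝ) 1, ENNReal.ofReal |t - a| *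
      (rlKernel α (t - ((t - a) * x + a)) * ENNReal.ofReal (((t - a) * x + a - a) ^ p)) =
      ENNReal.ofReal (ProbabilityTheory.beta (p + 1) α * (t - a) ^ (p + α)) *
        ENNReal.ofReal (1 / ProbabilityTheory.beta (p + 1) α * x ^ (p + 1 - 1) *
          (1 - x) ^ (α - 1)) := by
    intro x hx
    have hx1 : 0 < 1 - x := sub_pos.2 hx.2
    have hx0 := hx.1
    have e : t - ((t - a) * x + a) = (t - a) * (1 - x) := by ring
    rw [rlKernel, e, if_pos (by positivity), abs_of_pos hta, ← ENNReal.ofReal_mul (by positivity),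
      ← ENNReal.ofReal_mul hta.le, ← ENNReal.ofReal_mul (by positivity),
      add_sub_cancel_right, add_sub_cancel_right, Real.mul_rpow hta.le hx1.le,
      Real.mul_rpow hta.le hx0.le]
    congr 1
    have : (t - a) ^ (p + α) = (t - a) * (t - a) ^ (α - 1) * (t - a) ^ p := by
      rw [Real.rpow_sub_one hta.ne', Real.rpow_add hta]
      field_simp
    rw [this]
    field_simp
  rw [setLIntegral_congr_fun measurableSet_Ioo h2, lintegral_const_mul' _ _ ENNReal.ofReal_ne_top,
    ← ProbabilityTheory.lintegral_betaPDF,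
    ProbabilityTheory.lintegral_betaPDF_eq_one (by positivity) hα, mul_one,
    ProbabilityTheory.beta, mul_comm (Real.Gamma α)]

lemma eq_zero_of_le_lintegral_rlKernel {α lam a b : ℝ} (hα : 0 < α) (hlam : 0 ≤ lam)
    {d : ℝ → ENNReal} (hd : AEMeasurable d (volume.restrict (Set.Ioc a b)))
    (hd_fin : ∫⁻ s in Set.Ioc a b, d s ≠ ⊤)
    (hle : ∀ t ∈ Set.Ioc a b,
      d t ≤ ENNReal.ofReal lam * ∫⁻ r in Set.Ioc a b, rlKernel α (t - r) * d r) :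
    ∀ t ∈ Set.Ioc a b, d t = 0 := by
  set ν := volume.restrict (Set.Ioc a b)
  have hG := Real.Gamma_pos_of_pos hα
  set M := 2 * lam * Real.Gamma α + 1
  have hM0 : 0 < M := by positivity
  set μ := M ^ α⁻¹
  have hμ0 : 0 < μ := by positivity
  have hμα : μ ^ α = M := Real.rpow_inv_rpow hM0.le hα.ne'
  let e : ℝ → ENNReal := fun s => ENNReal.ofReal (Real.exp (-(μ * (s - a))))
  have he : Measurable e := by fun_prop
  have hk : Measurable fun x : ℝ => rlKernel α x := measurable_rlKernel α
  set J := ∫⁻ s, e s * d s ∂ν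
  have hJ_fin : J ≠ ⊤ := by
    refine ne_top_of_le_ne_top hd_fin ?_
    refine setLIntegral_mono_ae' measurableSet_Ioc (Filter.Eventually.of_forall fun s hs => ?_)
    have : e s ≤ 1 := by
      rw [← ENNReal.ofReal_one]
      refine ENNReal.ofReal_le_ofReal (Real.exp_le_one_iff.2 ?_)
      have := mul_pos hμ0 (sub_pos.2 hs.1)
      linarith
    calc e s * d s ≤ 1 * d s := by gcongr
      _ = d s := one_mul _
  have hJ_le : J ≤ ENNReal.ofReal (1 / 2) * J := by
    calc J ≤ ∫⁻ s, ENNReal.ofReal lam * ∫⁻ r, e s * (rlKernel α (s - r) * d r) ∂ν ∂ν := by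
          refine setLIntegral_mono_ae' measurableSet_Ioc
            (Filter.Eventually.of_forall fun s hs => ?_)
          rw [lintegral_const_mul' _ _ ENNReal.ofReal_ne_top, mul_left_comm]
          gcongr
          exact hle s hs
      _ = ENNReal.ofReal lam * ∫⁻ r, ∫⁻ s, e s * (rlKernel α (s - r) * d r) ∂ν ∂ν := by
          rw [lintegral_const_mul' _ _ ENNReal.ofReal_ne_top, lintegral_lintegral_swap]
          refine ((he.comp measurable_fst).aemeasurable).mul (AEMeasurable.mul ?_ hd.comp_snd)
          exact (hk.comp (measurable_fst.sub measurable_snd)).aemeasurable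
      _ ≤ ENNReal.ofReal lam * ∫⁻ r, ENNReal.ofReal (Real.Gamma α / μ ^ α) * (e r * d r) ∂ν := by
          gcongr with r
          calc ∫⁻ s, e s * (rlKernel α (s - r) * d r) ∂ν
              = ∫⁻ s, (e r * d r) *
                  (ENNReal.ofReal (Real.exp (-(μ * (s - r)))) * rlKernel α (s - r)) ∂ν := by
                refine lintegral_congr fun s => ?_
                have : e s = e r * ENNReal.ofReal (Real.exp (-(μ * (s - r)))) := by
                  rw [← ENNReal.ofReal_mul (Real.exp_pos _).le, ← Real.exp_add]
                  simp only [e]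
                  congr 2
                  ring
                rw [this]
                ring
            _ = (e r * d r) *
                  ∫⁻ s, ENNReal.ofReal (Real.exp (-(μ * (s - r)))) * rlKernel α (s - r) ∂ν := by
                refine lintegral_const_mul _ ?_
                exact Measurable.mul (by fun_prop) (hk.comp (measurable_id.sub_const r))
            _ ≤ (e r * d r) * ENNReal.ofReal (Real.Gamma α / μ ^ α) := by
                rw [← lintegral_exp_mul_rlKernel hα hμ0 r]
                gcongr
                exact Measure.restrict_le_self
            _ = _ := mul_comm _ _
      _ = ENNReal.ofReal (lam * (Real.Gamma α / μ ^ α)) * J := by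
          rw [lintegral_const_mul' _ _ ENNReal.ofReal_ne_top, ENNReal.ofReal_mul hlam, mul_assoc]
      _ ≤ ENNReal.ofReal (1 / 2) * J := by
          gcongr
          rw [hμα, ← mul_div_assoc, div_le_div_iff₀ hM0 two_pos]
          linarith
  have hJ0 : J = 0 := by
    by_contra h0
    have : ENNReal.ofReal (1 / 2) * J < 1 * J :=
      ENNReal.mul_lt_mul_left h0 hJ_fin (by rw [← ENNReal.ofReal_one]; exact
        (ENNReal.ofReal_lt_ofReal_iff one_pos).2 (by norm_num))
    rw [one_mul] at this
    exact absurd hJ_le this.not_ge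
  have hd0 : ∀ᵐ s ∂ν, d s = 0 := by
    filter_upwards [(lintegral_eq_zero_iff' (he.aemeasurable.mul hd)).1 hJ0] with s hs
    refine (mul_eq_zero.1 hs).resolve_left ?_
    simp [e, Real.exp_pos]
  intro t ht
  have : ∫⁻ r, rlKernel α (t - r) * d r ∂ν = 0 := by
    rw [← lintegral_zero (μ := ν)]
    refine lintegral_congr_ae ?_
    filter_upwards [hd0] with r hr
    simp [hr]
  simpa [this] using hle t ht

lemma ofReal_mittagLeffler_eq_one_add_lintegral {α lam a b t : ℝ} (hα : 0 < α) (hlam : 0 ≤ lam)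
    (ht : t ∈ Set.Ioc a b) :
    ENNReal.ofReal (mittagLeffler α (lam * Real.Gamma α * (t - a) ^ α)) =
      1 + ENNReal.ofReal lam * ∫⁻ r in Set.Ioc a b, rlKernel α (t - r) *
        ENNReal.ofReal (mittagLeffler α (lam * Real.Gamma α * (r - a) ^ α)) := by
  have hG := Real.Gamma_pos_of_pos hα
  have hpos : ∀ n : ℕ, 0 < Real.Gamma (α * n + 1) := fun n =>
    Real.Gamma_pos_of_pos (by positivity)
  have hexp : ∀ s, a < s → ∀ n : ℕ,
      (lam * Real.Gamma α * (s - a) ^ α) ^ n / Real.Gamma (α * n + 1) =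
        (lam * Real.Gamma α) ^ n / Real.Gamma (α * n + 1) * (s - a) ^ (α * n) := by
    intro s hs n
    rw [mul_pow, Real.rpow_mul (sub_pos.2 hs).le, Real.rpow_natCast]
    ring
  have hz : ∀ s, a < s → 0 ≤ lam * Real.Gamma α * (s - a) ^ α := fun s hs => by
    have := sub_pos.2 hs
    positivity
  have hterm : ∀ n : ℕ, ∫⁻ r in Set.Ioc a b, rlKernel α (t - r) *
      ENNReal.ofReal ((lam * Real.Gamma α) ^ n / Real.Gamma (α * n + 1) * (r - a) ^ (α * n)) =
      ENNReal.ofReal ((lam * Real.Gamma α) ^ n * Real.Gamma α /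
        Real.Gamma (α * (n + 1 : ℕ) + 1) * (t - a) ^ (α * (n + 1 : ℕ))) := by
    intro n
    have hc : 0 ≤ (lam * Real.Gamma α) ^ n / Real.Gamma (α * n + 1) := by
      have := hpos n
      positivity
    simp_rw [ENNReal.ofReal_mul hc, mul_left_comm (rlKernel α _) (ENNReal.ofReal (_ / _))]
    rw [lintegral_const_mul' _ _ ENNReal.ofReal_ne_top,
      lintegral_rlKernel_mul_rpow hα (by positivity) ht, ← ENNReal.ofReal_mul hc]
    have e1 : α * n + 1 + α = α * (n + 1 : ℕ) + 1 := by push_cast; ring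
    have e2 : α * n + α = α * (n + 1 : ℕ) := by push_cast; ring
    rw [e1, e2]
    congr 1
    have := (hpos n).ne'
    field_simp
  have hint : ∫⁻ r in Set.Ioc a b, rlKernel α (t - r) *
        ENNReal.ofReal (mittagLeffler α (lam * Real.Gamma α * (r - a) ^ α)) =
      ∑' n : ℕ, ENNReal.ofReal ((lam * Real.Gamma α) ^ n * Real.Gamma α /
        Real.Gamma (α * (n + 1 : ℕ) + 1) * (t - a) ^ (α * (n + 1 : ℕ))) := by
    rw [← tsum_congr hterm, ← lintegral_tsum (f := fun (n : ℕ) r => rlKernel α (t - r) *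
      ENNReal.ofReal ((lam * Real.Gamma α) ^ n / Real.Gamma (α * n + 1) * (r - a) ^ (α * n)))]
    · refine setLIntegral_congr_fun measurableSet_Ioc fun r hr => ?_
      rw [ENNReal.tsum_mul_left, ofReal_mittagLeffler hα (hz r hr.1)]
      simp_rw [hexp r hr.1]
    · intro n
      exact (((measurable_rlKernel α).comp (measurable_id.const_sub t)).mul
        (Measurable.ennreal_ofReal (by fun_prop))).aemeasurable
  rw [hint, ofReal_mittagLeffler hα (hz t ht.1), tsum_eq_zero_add' ENNReal.summable,
    ← ENNReal.tsum_mul_left]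
  congr 1
  · simp
  · refine tsum_congr fun n => ?_
    rw [hexp t ht.1, ← ENNReal.ofReal_mul hlam]
    congr 1
    rw [pow_succ]
    ring

/-- Fractional Gronwall inequality with a constant forcing term. -/
lemma fractional_gronwall_const {α lam a b W : ℝ} (hα : 0 < α) (hlam : 0 ≤ lam) (hW : 0 ≤ W)
    {u : ℝ → ℝ} (hu_int : IntegrableOn u (Set.Ioc a b)) (hu : ∀ t ∈ Set.Ioc a b, 0 ≤ u t)
    (hle : ∀ t ∈ Set.Ioc a b, u t ≤ W + lam * ∫ s in a..t, (t - s) ^ (α - 1) * u s) :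
    ∀ t ∈ Set.Ioc a b, u t ≤ W * mittagLeffler α (lam * Real.Gamma α * (t - a) ^ α) := by
  let f : ℝ → ENNReal := fun t => ENNReal.ofReal (u t)
  let E : ℝ → ENNReal := fun t =>
    ENNReal.ofReal (mittagLeffler α (lam * Real.Gamma α * (t - a) ^ α))
  let g : ℝ → ENNReal := fun t => ENNReal.ofReal W * E t
  have hf : AEMeasurable f (volume.restrict (Set.Ioc a b)) := hu_int.aemeasurable.ennreal_ofReal
  have hk : ∀ t, Measurable fun r => rlKernel α (t - r) := fun t =>
    (measurable_rlKernel α).comp (measurable_id.const_sub t)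
  have hE : AEMeasurable E (volume.restrict (Set.Ioc a b)) := by
    have hm : Measurable fun r => ∑' n : ℕ, ENNReal.ofReal
        ((lam * Real.Gamma α * (r - a) ^ α) ^ n / Real.Gamma (α * n + 1)) :=
      Measurable.tsum fun n => by fun_prop
    refine hm.aemeasurable.congr ?_
    filter_upwards [ae_restrict_mem measurableSet_Ioc] with r hr
    have := sub_pos.2 hr.1
    have hG := Real.Gamma_pos_of_pos hα
    exact (ofReal_mittagLeffler hα (by positivity)).symm
  have hg : AEMeasurable g (volume.restrict (Set.Ioc a b)) := hE.const_mul _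
  have hf_le : ∀ t ∈ Set.Ioc a b, f t ≤ ENNReal.ofReal W +
      ENNReal.ofReal lam * ∫⁻ r in Set.Ioc a b, rlKernel α (t - r) * f r := by
    intro t ht
    refine (ENNReal.ofReal_le_ofReal (hle t ht)).trans (ENNReal.ofReal_add_le.trans ?_)
    rw [ENNReal.ofReal_mul hlam]
    gcongr
    rw [intervalIntegral.integral_of_le ht.1.le]
    by_cases hi : IntegrableOn (fun s => (t - s) ^ (α - 1) * u s) (Set.Ioc a t)
    · rw [ofReal_integral_eq_lintegral_ofReal hi]
      · calc ∫⁻ s in Set.Ioc a t, ENNReal.ofReal ((t - s) ^ (α - 1) * u s)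
            = ∫⁻ s in Set.Ioc a t, rlKernel α (t - s) * f s := by
              refine setLIntegral_congr_fun measurableSet_Ioc fun s hs => ?_
              have := sub_nonneg.2 hs.2
              simp only [f, rlKernel]
              rw [if_pos this, ENNReal.ofReal_mul (by positivity)]
          _ ≤ _ := lintegral_mono_set (Set.Ioc_subset_Ioc_right ht.2)
      · filter_upwards [ae_restrict_mem measurableSet_Ioc] with s hs
        have h1 := sub_nonneg.2 hs.2
        have h2 := hu s ⟨hs.1, hs.2.trans ht.2⟩
        simp only [Pi.zero_apply]
        positivity
    · rw [integral_undef hi]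
      simp
  have hg_eq : ∀ t ∈ Set.Ioc a b, g t = ENNReal.ofReal W +
      ENNReal.ofReal lam * ∫⁻ r in Set.Ioc a b, rlKernel α (t - r) * g r := by
    intro t ht
    simp only [g, E]
    simp_rw [mul_left_comm (rlKernel α _) (ENNReal.ofReal W)]
    rw [lintegral_const_mul' _ _ ENNReal.ofReal_ne_top,
      ofReal_mittagLeffler_eq_one_add_lintegral hα hlam ht]
    ring
  have hd : ∀ t ∈ Set.Ioc a b, f t - g t = 0 := by
    refine eq_zero_of_le_lintegral_rlKernel (d := fun t => f t - g t) hα hlam (hf.sub hg) ?_ ?_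
    · refine ne_top_of_le_ne_top ?_ (lintegral_mono fun t => tsub_le_self)
      exact hu_int.lintegral_lt_top.ne
    · intro t ht
      rw [tsub_le_iff_right]
      calc f t ≤ ENNReal.ofReal W +
            ENNReal.ofReal lam * ∫⁻ r in Set.Ioc a b, rlKernel α (t - r) * f r := hf_le t ht
        _ ≤ ENNReal.ofReal W + ENNReal.ofReal lam * ∫⁻ r in Set.Ioc a b,
              (rlKernel α (t - r) * (f r - g r) + rlKernel α (t - r) * g r) := by
            gcongr with r
            rw [← mul_add]
            gcongr
            exact le_tsub_add
        _ = _ := by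
            have hm : AEMeasurable (fun r => rlKernel α (t - r) * g r)
                (volume.restrict (Set.Ioc a b)) :=
              (hk t).aemeasurable.mul hg
            rw [lintegral_add_right' _ hm, hg_eq t ht]
            ring
  intro t ht
  have hz : 0 ≤ lam * Real.Gamma α * (t - a) ^ α := by
    have := sub_pos.2 ht.1
    have hG := Real.Gamma_pos_of_pos hα
    positivity
  have h := tsub_eq_zero_iff_le.1 (hd t ht)
  simp only [f, g, E] at h
  rw [← ENNReal.ofReal_mul hW] at h
  exact (ENNReal.ofReal_le_ofReal_iff (mul_nonneg hW (mittagLeffler_nonneg hα hz))).1 h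

/-- Impulsive fractional Gronwall inequality with constant multiplier `λ`
    (Corollary 2.7 of Choi–Koo, particular case of the paper's Theorem 2). -/
theorem impulsive_fractional_gronwall_const_lambda
    (α a T : ℝ) (hα : 0 < α) (haT : a < T)
    (m : ℕ) (tp : ℕ → ℝ)
    (htp0 : tp 0 = a) (htpT : tp (m + 1) = T)
    (htp_mono : ∀ i ≤ m, tp i < tp (i + 1))
    (lam : ℝ) (hlam : 0 ≤ lam)
    (β : ℕ → ℝ) (hβ : ∀ i, 1 ≤ i → i ≤ m → 0 < β i)
    (u v : ℝ → ℝ)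
    (hu_int : IntegrableOn u (Set.Icc a T))
    (hv_int : IntegrableOn v (Set.Icc a T))
    (hu_nonneg : ∀ t ∈ Set.Icc a T, 0 ≤ u t)
    (hv_nonneg : ∀ t ∈ Set.Icc a T, 0 ≤ v t)
    (hv_mono : MonotoneOn v (Set.Icc a T))
    (hineq : ∀ t ∈ Set.Icc a T,
      u t ≤ v t + lam * (∫ s in a..t, (t - s) ^ (α - 1) * u s) +
        ∑ i ∈ (Finset.Icc 1 m).filter (fun i => tp i < t), β i * u (tp i)) :
    ∀ k ≤ m, ∀ t ∈ Set.Ioc (tp k) (tp (k + 1)),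
      u t ≤ v t *
        (∏ i ∈ Finset.Icc 1 k,
          (1 + β i * mittagLeffler α (lam * Real.Gamma α * (tp i - a) ^ α))) *
        mittagLeffler α (lam * Real.Gamma α * (t - a) ^ α) := by
  have hmono : ∀ j, j ≤ m + 1 → ∀ i, i < j → tp i < tp j := by
    intro j
    induction j with
    | zero => intro _ i hi; omega
    | succ j ih =>
      intro hj i hi
      rcases Nat.lt_succ_iff_lt_or_eq.1 hi with h | rfl
      · exact (ih (by omega) i h).trans (htp_mono j (by omega))
      · exact htp_mono i (by omega)
  have hmono_le : ∀ j, j ≤ m + 1 → ∀ i, i ≤ j → tp i ≤ tp j := fun j hj i hi =>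
    hi.eq_or_lt.elim (fun h => h ▸ le_rfl) fun h => (hmono j hj i h).le
  have htp_gt : ∀ i, 1 ≤ i → i ≤ m + 1 → a < tp i := fun i h1 h2 => by
    rw [← htp0]; exact hmono i h2 0 (by omega)
  have htp_le : ∀ i, i ≤ m + 1 → tp i ≤ T := fun i h => by
    rw [← htpT]; exact hmono_le (m + 1) le_rfl i h
  set E : ℝ → ℝ := fun t => mittagLeffler α (lam * Real.Gamma α * (t - a) ^ α)
  have hG := Real.Gamma_pos_of_pos hα
  have hE0 : ∀ t, a < t → 0 ≤ E t := fun t ht => by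
    have := sub_pos.2 ht
    exact mittagLeffler_nonneg hα (by positivity)
  let P : ℕ → ℝ := fun k => ∏ i ∈ Finset.Icc 1 k, (1 + β i * E (tp i))
  have hP0 : ∀ k, k ≤ m → 0 ≤ P k := fun k hk => Finset.prod_nonneg fun i hi => by
    rw [Finset.mem_Icc] at hi
    have := hE0 (tp i) (htp_gt i hi.1 (by omega))
    have := hβ i hi.1 (by omega)
    positivity
  have hstep : ∀ k ≤ m, ∀ t ∈ Set.Ioc (tp k) (tp (k + 1)),
      u t ≤ (v t + ∑ i ∈ Finset.Icc 1 k, β i * u (tp i)) * E t := by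
    intro k hk t ht
    have hat : a < t := (htp0 ▸ hmono_le k (by omega) 0 (by omega) : a ≤ tp k).trans_lt ht.1
    have htT : t ≤ T := ht.2.trans (htp_le _ (by omega))
    have hterm : ∀ i ∈ Finset.Icc 1 k, 0 ≤ β i * u (tp i) := fun i hi => by
      rw [Finset.mem_Icc] at hi
      exact mul_nonneg (hβ i hi.1 (by omega)).le
        (hu_nonneg _ ⟨(htp_gt i hi.1 (by omega)).le, htp_le i (by omega)⟩)
    refine fractional_gronwall_const (b := t) hα hlam
      (add_nonneg (hv_nonneg t ⟨hat.le, htT⟩) (Finset.sum_nonneg hterm))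
      (hu_int.mono_set fun s hs => ⟨hs.1.le, hs.2.trans htT⟩)
      (fun s hs => hu_nonneg s ⟨hs.1.le, hs.2.trans htT⟩) (fun s hs => ?_) t ⟨hat, le_rfl⟩
    have hsI : s ∈ Set.Icc a T := ⟨hs.1.le, hs.2.trans htT⟩
    have h1 := hineq s hsI
    have h2 := hv_mono hsI ⟨hat.le, htT⟩ hs.2
    have h3 : ∑ i ∈ (Finset.Icc 1 m).filter (fun i => tp i < s), β i * u (tp i) ≤
        ∑ i ∈ Finset.Icc 1 k, β i * u (tp i) := by
      refine Finset.sum_le_sum_of_subset_of_nonneg (fun i hi => ?_) fun i hi _ => hterm i hi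
      rw [Finset.mem_filter, Finset.mem_Icc] at hi
      rw [Finset.mem_Icc]
      refine ⟨hi.1.1, ?_⟩
      by_contra! hki
      have := hmono_le i (by omega) (k + 1) hki
      linarith [hi.2, hs.2, ht.2]
    linarith
  intro k
  induction k using Nat.strong_induction_on with
  | _ k ih =>
    intro hk t ht
    have hat : a < t := (htp0 ▸ hmono_le k (by omega) 0 (by omega) : a ≤ tp k).trans_lt ht.1
    have htT : t ≤ T := ht.2.trans (htp_le _ (by omega))
    have hsum : ∀ j ≤ k, v t + ∑ i ∈ Finset.Icc 1 j, β i * u (tp i) ≤ v t * P j := by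
      intro j
      induction j with
      | zero => intro _; simp [P]
      | succ j ihj =>
        intro hj
        have hu_le := ih j (by omega) (by omega) (tp (j + 1)) ⟨htp_mono j (by omega), le_rfl⟩
        have hv_le : v (tp (j + 1)) ≤ v t :=
          hv_mono ⟨(htp_gt (j + 1) (by omega) (by omega)).le, htp_le _ (by omega)⟩ ⟨hat.le, htT⟩
            ((hmono_le k (by omega) (j + 1) hj).trans ht.1.le)
        have hPE : 0 ≤ P j * E (tp (j + 1)) :=
          mul_nonneg (hP0 j (by omega)) (hE0 _ (htp_gt (j + 1) (by omega) (by omega)))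
        have hb := hβ (j + 1) (by omega) (by omega)
        have hPs : P (j + 1) = P j * (1 + β (j + 1) * E (tp (j + 1))) :=
          Finset.prod_Icc_succ_top (by omega) _
        rw [Finset.sum_Icc_succ_top (by omega), hPs]
        have h1 : u (tp (j + 1)) ≤ v t * (P j * E (tp (j + 1))) :=
          hu_le.trans (by rw [mul_assoc]; exact mul_le_mul_of_nonneg_right hv_le hPE)
        have h2 := mul_le_mul_of_nonneg_left h1 hb.le
        have h3 := ihj (by omega)
        linarith
    exact (hstep k hk t ht).trans (mul_le_mul_of_nonneg_right (hsum k le_rfl) (hE0 t hat))
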